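/- Let Γ ⊆ PGLₙ(ℂ) be a subgroup such that every element g ∈ Γ satisfies g^d = 1 for a fixed positive integer d. Then Γ is finite and its order divides (nd)^n. -/

import Mathlib

open Matrix

open Module Polynomial

section Diagonalization

variable {V : Type} [AddCommGroup V] [Module ℂ V]

/-- An endomorphism of finite order of a complex vector space is diagonalizable, with roots of
unity as eigenvalues. -/
theorem exists_eigenbasis_of_pow_eq_one [FiniteDimensional ℂ V] {e : ℕ} (he : 0 < e)
    {f : End ℂ V} (hf : f ^ e = 1) :
    ∃ (b : Basis (Fin (finrank ℂ V)) ℂ V) (μ : Fin (finrank ℂ V) → ℂ),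
      (∀ i, f (b i) = μ i • b i) ∧ ∀ i, μ i ^ e = 1 := by
  have hss : f.IsSemisimple := by
    refine End.isSemisimple_of_squarefree_aeval_eq_zero (p := X ^ e - 1)
      (X_pow_sub_one_separable_iff.2 (by exact_mod_cast he.ne')).squarefree ?_
    simp [hf]
  have htop : ⨆ μ, f.eigenspace μ = ⊤ := by
    simpa [hss.isFinitelySemisimple.maxGenEigenspace_eq_eigenspace] using
      End.iSup_maxGenEigenspace_eq_top f
  let s : Set V := {v | ∃ μ : ℂ, f v = μ • v}
  have hs : ⊤ ≤ Submodule.span ℂ s := by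
    rw [← htop, iSup_le_iff]
    exact fun μ v hv ↦ Submodule.subset_span ⟨μ, End.mem_eigenspace_iff.1 hv⟩
  let b₀ := Basis.ofSpan hs
  let b := b₀.reindex (Fintype.equivFinOfCardEq (finrank_eq_card_basis b₀).symm)
  have hb : ∀ i, ∃ μ : ℂ, f (b i) = μ • b i := fun i ↦ by
    rw [Basis.reindex_apply]
    exact Basis.ofSpan_subset hs (Set.mem_range_self _)
  choose μ hμ using hb
  refine ⟨b, μ, hμ, fun i ↦ ?_⟩
  have hpow : ∀ k, (f ^ k) (b i) = μ i ^ k • b i := fun k ↦ by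
    induction k with
    | zero => simp
    | succ k ih => rw [pow_succ', Module.End.mul_apply, ih, map_smul, hμ, smul_smul, pow_succ]
  have h := hpow e
  rw [hf, Module.End.one_apply] at h
  have h' : (μ i ^ e - 1) • b i = 0 := by rw [sub_smul, ← h, one_smul, sub_self]
  exact sub_eq_zero.1 ((smul_eq_zero.1 h').resolve_right (b.ne_zero i))

theorem toMatrix_eq_diagonal_of_eigenbasis {ι : Type*} [Fintype ι] [DecidableEq ι]
    {f : End ℂ V} (b : Basis ι ℂ V) {μ : ι → ℂ} (h : ∀ i, f (b i) = μ i • b i) :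
    LinearMap.toMatrix b b f = diagonal μ := by
  ext i j
  rw [LinearMap.toMatrix_apply, h, map_smul, Basis.repr_self]
  by_cases hij : i = j
  · simp [hij]
  · simp [hij, Finsupp.single_eq_of_ne hij]

theorem trace_eq_sum_of_eigenbasis {ι : Type*} [Fintype ι] [DecidableEq ι]
    {f : End ℂ V} (b : Basis ι ℂ V) {μ : ι → ℂ} (h : ∀ i, f (b i) = μ i • b i) :
    LinearMap.trace ℂ V f = ∑ i, μ i := by
  rw [LinearMap.trace_eq_matrix_trace ℂ b, toMatrix_eq_diagonal_of_eigenbasis b h, trace_diagonal]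

theorem trace_exteriorPower_map_of_eigenbasis {n : ℕ} {f : End ℂ V} (b : Basis (Fin n) ℂ V)
    {μ : Fin n → ℂ} (h : ∀ i, f (b i) = μ i • b i) (k : ℕ) :
    LinearMap.trace ℂ _ (exteriorPower.map k f) =
      ∑ s ∈ Finset.powersetCard k Finset.univ, ∏ i ∈ s, μ i := by
  have hb : ∀ s : Set.powersetCard (Fin n) k, exteriorPower.map k f (b.exteriorPower k s) =
      (∏ i ∈ (s : Finset (Fin n)), μ i) • b.exteriorPower k s := fun s ↦ by
    rw [exteriorPower.basis_apply, exteriorPower.map_apply_ιMulti_family]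
    simp only [exteriorPower.ιMulti_family, Function.comp_def, h]
    rw [AlternatingMap.map_smul_univ]
    congr 1
    rw [← Finset.map_orderEmbOfFin_univ s.1 s.2, Finset.prod_map]
    rfl
  rw [trace_eq_sum_of_eigenbasis _ hb]
  exact (Finset.sum_subtype (p := (· ∈ Set.powersetCard (Fin n) k)) _ (fun s ↦ by
    rw [Finset.mem_powersetCard_univ, Set.powersetCard.mem_iff]) fun s ↦ ∏ i ∈ s, μ i).symm

theorem det_sub_algebraMap_of_eigenbasis {n : ℕ} {f : End ℂ V} (b : Basis (Fin n) ℂ V)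
    {μ : Fin n → ℂ} (h : ∀ i, f (b i) = μ i • b i) (c : ℂ) :
    LinearMap.det (f - algebraMap ℂ (End ℂ V) c) = ∏ i, (μ i - c) := by
  have h' : ∀ i, (f - algebraMap ℂ (End ℂ V) c) (b i) = (μ i - c) • b i := fun i ↦ by
    simp [h, sub_smul]
  rw [← LinearMap.det_toMatrix b, toMatrix_eq_diagonal_of_eigenbasis b h', det_diagonal]

theorem det_sub_algebraMap_eq_sum_trace_exteriorPower [FiniteDimensional ℂ V] {e : ℕ}
    (he : 0 < e) {f : End ℂ V} (hf : f ^ e = 1) (c : ℂ) :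
    LinearMap.det (f - algebraMap ℂ (End ℂ V) c) =
      ∑ k ∈ Finset.range (finrank ℂ V + 1),
        (-c) ^ (finrank ℂ V - k) * LinearMap.trace ℂ _ (exteriorPower.map k f) := by
  obtain ⟨b, μ, hμ, -⟩ := exists_eigenbasis_of_pow_eq_one he hf
  rw [det_sub_algebraMap_of_eigenbasis b hμ]
  simp_rw [trace_exteriorPower_map_of_eigenbasis b hμ, sub_eq_add_neg]
  rw [Finset.prod_add, Finset.sum_powerset, Finset.card_univ, Fintype.card_fin]
  refine Finset.sum_congr rfl fun k _ ↦ ?_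
  rw [Finset.mul_sum]
  refine Finset.sum_congr rfl fun s hs ↦ ?_
  rw [Finset.prod_const, Finset.card_sdiff_of_subset (Finset.subset_univ s),
    (Finset.mem_powersetCard.1 hs).2, Finset.card_univ, Fintype.card_fin, mul_comm]

theorem finite_setOf_trace_of_pow_eq_one [FiniteDimensional ℂ V] {e : ℕ} (he : 0 < e) :
    {t : ℂ | ∃ f : End ℂ V, f ^ e = 1 ∧ LinearMap.trace ℂ V f = t}.Finite := by
  have hroots : {z : ℂ | z ^ e = 1}.Finite :=
    (nthRootsFinset e (1 : ℂ)).finite_toSet.subset fun z hz ↦ (mem_nthRootsFinset he 1).2 hz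
  refine ((Set.Finite.pi' fun _ : Fin (finrank ℂ V) ↦ hroots).image fun μ ↦ ∑ i, μ i).subset ?_
  rintro _ ⟨f, hf, rfl⟩
  obtain ⟨b, μ, hμ, hμe⟩ := exists_eigenbasis_of_pow_eq_one he hf
  exact ⟨μ, hμe, (trace_eq_sum_of_eigenbasis b hμ).symm⟩

theorem eq_one_of_trace_pow_eq_finrank [FiniteDimensional ℂ V] {e : ℕ} (he : 0 < e)
    {f : End ℂ V} (hf : f ^ e = 1) (h : ∀ k, LinearMap.trace ℂ V (f ^ k) = finrank ℂ V) : f = 1 := by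
  have he' : (e : ℂ) ≠ 0 := by exact_mod_cast he.ne'
  set S : End ℂ V := ∑ k ∈ Finset.range e, f ^ k with hS
  have hfS : f * S = S := by
    have := mul_geom_sum f e
    rwa [hf, sub_self, sub_mul, one_mul, sub_eq_zero] at this
  have hpS : ∀ k, f ^ k * S = S := fun k ↦ by
    induction k with
    | zero => simp
    | succ k ih => rw [pow_succ, mul_assoc, hfS, ih]
  have hSS : S * S = (e : ℂ) • S := by
    nth_rw 1 [hS]
    rw [Finset.sum_mul, Finset.sum_congr rfl fun k _ ↦ hpS k, Finset.sum_const, Finset.card_range,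
      Nat.cast_smul_eq_nsmul]
  have hP : IsIdempotentElem ((e : ℂ)⁻¹ • S) := by
    rw [IsIdempotentElem, smul_mul_smul_comm, hSS, smul_smul]
    congr 1
    field_simp
  have hP1 : (1 : End ℂ V) - (e : ℂ)⁻¹ • S = 0 := by
    refine (LinearMap.IsIdempotentElem.trace_eq_zero_iff hP.one_sub).1 ?_
    rw [map_sub, LinearMap.trace_one, map_smul, hS, map_sum]
    simp [h, he']
  calc f = f * ((e : ℂ)⁻¹ • S) := by rw [← sub_eq_zero.1 hP1, mul_one]
    _ = 1 := by rw [mul_smul_comm, hfS, sub_eq_zero.1 hP1]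

end Diagonalization

/-- **Burnside**: a complex linear group of finite exponent is finite. -/
theorem Representation.finite_of_pow_eq_one {G V : Type} [Group G] [AddCommGroup V] [Module ℂ V]
    [FiniteDimensional ℂ V] (ρ : Representation ℂ G V) (hρ : Function.Injective ρ)
    {e : ℕ} (he : 0 < e) (h : ∀ g : G, g ^ e = 1) : Finite G := by
  have hpow : ∀ g, ρ g ^ e = 1 := fun g ↦ by rw [← map_pow, h, map_one]
  obtain ⟨T, hTsub, hT⟩ := (Submodule.fg_span_iff_fg_span_finset_subset (Set.range ρ)).1
    (IsNoetherian.noetherian (Submodule.span ℂ (Set.range ρ)))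
  have hfin := finite_setOf_trace_of_pow_eq_one (V := V) he
  have : Finite {t : ℂ | ∃ f : End ℂ V, f ^ e = 1 ∧ LinearMap.trace ℂ V f = t} := hfin
  let φ : G → T → {t : ℂ | ∃ f : End ℂ V, f ^ e = 1 ∧ LinearMap.trace ℂ V f = t} := fun g t ↦
    ⟨LinearMap.trace ℂ V (ρ g * t), ρ g * t, by
      obtain ⟨x, hx⟩ := hTsub t.2
      rw [← hx, ← map_mul, hpow], rfl⟩
  refine Finite.of_injective φ fun g₁ g₂ hg ↦ ?_
  have htr : ∀ x, LinearMap.trace ℂ V (ρ g₁ * ρ x) = LinearMap.trace ℂ V (ρ g₂ * ρ x) := by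
    intro x
    have hx : ρ x ∈ Submodule.span ℂ (T : Set (End ℂ V)) :=
      hT ▸ Submodule.subset_span ⟨x, rfl⟩
    refine LinearMap.eqOn_span (f := LinearMap.trace ℂ V ∘ₗ LinearMap.mulLeft ℂ (ρ g₁))
      (g := LinearMap.trace ℂ V ∘ₗ LinearMap.mulLeft ℂ (ρ g₂)) (fun t ht ↦ ?_) hx
    exact congrArg Subtype.val (congrFun hg ⟨t, ht⟩)
  have hone : ρ (g₂⁻¹ * g₁) = 1 := by
    refine eq_one_of_trace_pow_eq_finrank he (hpow _) fun k ↦ ?_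
    induction k with
    | zero => simp
    | succ k ih =>
      rw [← ih, ← map_pow, ← map_pow]
      have hk := htr ((g₂⁻¹ * g₁) ^ k * g₂⁻¹)
      rw [← map_mul, ← map_mul, ← mul_assoc, ← mul_assoc, map_mul, LinearMap.trace_mul_comm,
        ← map_mul, map_mul ρ (_ * _) g₂⁻¹, LinearMap.trace_mul_comm, ← map_mul] at hk
      simpa only [pow_succ', mul_assoc, inv_mul_cancel_left] using hk
  have := hρ (hone.trans (map_one ρ).symm)
  exact (inv_mul_eq_one.1 this).symm

/-- The characters of finite-dimensional complex representations of `G`. -/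
def characterSubmonoid (G : Type) [Group G] : Submonoid (G → ℂ) where
  carrier := {χ | ∃ (W : Type) (_ : AddCommGroup W) (_ : Module ℂ W) (_ : FiniteDimensional ℂ W)
    (ρ : Representation ℂ G W), χ = ρ.character}
  mul_mem' := by
    rintro _ _ ⟨W₁, _, _, _, ρ₁, rfl⟩ ⟨W₂, _, _, _, ρ₂, rfl⟩
    exact ⟨TensorProduct ℂ W₁ W₂, _, _, inferInstance, ρ₁.tprod ρ₂,
      (Representation.char_tensor ρ₁ ρ₂).symm⟩
  one_mem' := by
    refine ⟨ℂ, _, _, inferInstance, Representation.trivial ℂ G ℂ, ?_⟩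
    ext g
    rw [Representation.character,
      show Representation.trivial ℂ G ℂ g = 1 from LinearMap.ext fun v ↦ by simp]
    simp

/-- The algebra of combinations of characters with algebraic integer coefficients. -/
noncomputable def characterSubalgebra (G : Type) [Group G] :
    Subalgebra (integralClosure ℤ ℂ) (G → ℂ) :=
  Algebra.adjoin _ (characterSubmonoid G : Set (G → ℂ))

theorem exists_isIntegral_sum_eq_of_mem_characterSubalgebra {G : Type} [Group G] [Fintype G]
    {θ : G → ℂ} (hθ : θ ∈ characterSubalgebra G) :
    ∃ a : ℂ, IsIntegral ℤ a ∧ ∑ g, θ g = Nat.card G * a := by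
  have hcard : (Nat.card G : ℂ) ≠ 0 := by exact_mod_cast Nat.card_pos.ne'
  rw [characterSubalgebra, ← Subalgebra.mem_toSubmodule, Algebra.adjoin_eq_span,
    Submonoid.closure_eq] at hθ
  induction hθ using Submodule.span_induction with
  | mem χ hχ =>
    obtain ⟨W, _, _, _, ρ, rfl⟩ := hχ
    have := invertibleOfNonzero hcard
    refine ⟨(finrank ℂ ρ.invariants : ℂ),
      isIntegral_algebraMap (R := ℤ) (x := finrank ℂ ρ.invariants), ?_⟩
    rw [← Representation.card_inv_mul_sum_char_eq_finrank, mul_inv_cancel_left₀ hcard]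
  | zero => exact ⟨0, isIntegral_zero, by simp⟩
  | add θ₁ θ₂ _ _ h₁ h₂ =>
    obtain ⟨a, ha, ha'⟩ := h₁
    obtain ⟨b, hb, hb'⟩ := h₂
    exact ⟨a + b, ha.add hb, by simp [Finset.sum_add_distrib, ha', hb', mul_add]⟩
  | smul c θ _ h =>
    obtain ⟨a, ha, ha'⟩ := h
    refine ⟨c * a, c.2.mul ha, ?_⟩
    have : ∀ g, (c • θ) g = c * θ g := fun g ↦ rfl
    simp only [this, ← Finset.mul_sum, ha']
    ring

/-- The representation induced on an exterior power. -/
noncomputable def Representation.exteriorPowerMap {G V : Type} [Group G] [AddCommGroup V]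
    [Module ℂ V] (ρ : Representation ℂ G V) (k : ℕ) : Representation ℂ G (⋀[ℂ]^k V) where
  toFun g := exteriorPower.map k (ρ g)
  map_one' := by rw [map_one]; exact exteriorPower.map_id
  map_mul' g h := by rw [map_mul]; exact exteriorPower.map_comp _ _

section Exponent

variable {G V : Type} [Group G] [AddCommGroup V] [Module ℂ V] [FiniteDimensional ℂ V]
  (ρ : Representation ℂ G V) {e : ℕ}

theorem det_sub_algebraMap_mem_characterSubalgebra (he : 0 < e) (h : ∀ g : G, g ^ e = 1)
    {c : ℂ} (hc : IsIntegral ℤ c) :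
    (fun g ↦ LinearMap.det (ρ g - algebraMap ℂ (End ℂ V) c)) ∈ characterSubalgebra G := by
  have hc' : ∀ m : ℕ, IsIntegral ℤ ((-c) ^ m) := fun m ↦ hc.neg.pow m
  have hsum : (fun g ↦ LinearMap.det (ρ g - algebraMap ℂ (End ℂ V) c)) =
      ∑ k ∈ Finset.range (finrank ℂ V + 1),
        (⟨_, hc' (finrank ℂ V - k)⟩ : integralClosure ℤ ℂ) • (ρ.exteriorPowerMap k).character := by
    ext g
    rw [det_sub_algebraMap_eq_sum_trace_exteriorPower he (by rw [← map_pow, h, map_one]),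
      Finset.sum_apply]
    rfl
  rw [hsum]
  exact Subalgebra.sum_mem _ fun k _ ↦ Subalgebra.smul_mem _
    (Algebra.subset_adjoin (show _ ∈ characterSubmonoid G from
      ⟨_, _, _, inferInstance, ρ.exteriorPowerMap k, rfl⟩)) _

theorem det_geom_sum_mem_characterSubalgebra (he : 0 < e) (h : ∀ g : G, g ^ e = 1) :
    (fun g ↦ LinearMap.det (∑ i ∈ Finset.range e, ρ g ^ i)) ∈ characterSubalgebra G := by
  have hζ := Complex.isPrimitiveRoot_exp e he.ne'
  have hprod : ∏ μ ∈ (nthRootsFinset e (1 : ℂ)).erase 1, (X - C μ) =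
      ∑ i ∈ Finset.range e, X ^ i := by
    refine mul_left_cancel₀ (X_sub_C_ne_zero (1 : ℂ)) ?_
    rw [Finset.mul_prod_erase _ (fun μ ↦ X - C μ) ((mem_nthRootsFinset he 1).2 (one_pow e)),
      ← X_pow_sub_one_eq_prod he hζ, C_1, mul_geom_sum]
  have hdet : (fun g ↦ LinearMap.det (∑ i ∈ Finset.range e, ρ g ^ i)) =
      ∏ μ ∈ (nthRootsFinset e (1 : ℂ)).erase 1,
        fun g ↦ LinearMap.det (ρ g - algebraMap ℂ (End ℂ V) μ) := by
    ext g
    have hg := map_prod ((LinearMap.det (A := ℂ) (M := V)).comp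
      (aeval (ρ g) : ℂ[X] →ₐ[ℂ] End ℂ V).toMonoidHom) (fun μ ↦ X - C μ)
      ((nthRootsFinset e (1 : ℂ)).erase 1)
    simpa [hprod] using hg
  rw [hdet]
  refine Subalgebra.prod_mem _ fun μ hμ ↦ det_sub_algebraMap_mem_characterSubalgebra ρ he h ?_
  refine IsIntegral.of_pow he ?_
  rw [(mem_nthRootsFinset he 1).1 (Finset.mem_of_mem_erase hμ)]
  exact isIntegral_one

/-- The order of a finite complex linear group of exponent dividing `e` in dimension `n`
divides `e ^ n`. -/
theorem Representation.natCard_dvd_pow_finrank [Finite G] (hρ : Function.Injective ρ)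
    (he : 0 < e) (h : ∀ g : G, g ^ e = 1) : Nat.card G ∣ e ^ finrank ℂ V := by
  have := Fintype.ofFinite G
  obtain ⟨a, ha, hsum⟩ := exists_isIntegral_sum_eq_of_mem_characterSubalgebra
    (det_geom_sum_mem_characterSubalgebra ρ he h)
  have hzero : ∀ g ≠ 1, LinearMap.det (∑ i ∈ Finset.range e, ρ g ^ i) = 0 := by
    intro g hg
    by_contra hdet
    have hunit : IsUnit (∑ i ∈ Finset.range e, ρ g ^ i) :=
      (LinearMap.isUnit_iff_isUnit_det _).2 (isUnit_iff_ne_zero.2 hdet)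
    have hmul := mul_geom_sum (ρ g) e
    rw [← map_pow, h, map_one, sub_self, hunit.mul_left_eq_zero, sub_eq_zero] at hmul
    exact hg (hρ (hmul.trans (map_one ρ).symm))
  have hone : LinearMap.det (∑ i ∈ Finset.range e, ρ 1 ^ i) = (e : ℂ) ^ finrank ℂ V := by
    have : ∑ i ∈ Finset.range e, ρ 1 ^ i = (e : ℂ) • LinearMap.id := by
      simp [Nat.cast_smul_eq_nsmul, ← Module.End.one_eq_id]
    rw [this, LinearMap.det_smul, LinearMap.det_id, mul_one]
  rw [Fintype.sum_eq_single 1 hzero, hone] at hsum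
  have hcard : (Nat.card G : ℂ) ≠ 0 := by exact_mod_cast Nat.card_pos.ne'
  have hq : a = algebraMap ℚ ℂ ((e : ℚ) ^ finrank ℂ V / Nat.card G) := by
    rw [map_div₀, map_pow, map_natCast, map_natCast, hsum, mul_div_cancel_left₀ _ hcard]
  rw [hq, isIntegral_algebraMap_iff (algebraMap ℚ ℂ).injective] at ha
  obtain ⟨m, hm⟩ := IsIntegrallyClosed.isIntegral_iff.1 ha
  have hcardQ : (Nat.card G : ℚ) ≠ 0 := by exact_mod_cast Nat.card_pos.ne'
  rw [eq_div_iff hcardQ, eq_intCast] at hm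
  rw [← Int.natCast_dvd_natCast]
  refine ⟨m, ?_⟩
  rw [mul_comm]
  exact_mod_cast hm.symm

end Exponent

theorem exists_specialLinearGroup_toGL_mk_eq {n : ℕ} (hn : 0 < n)
    (x : GL (Fin n) ℂ ⧸ Subgroup.center (GL (Fin n) ℂ)) :
    ∃ A : SpecialLinearGroup (Fin n) ℂ, (QuotientGroup.mk (SpecialLinearGroup.toGL A) :
      GL (Fin n) ℂ ⧸ Subgroup.center (GL (Fin n) ℂ)) = x := by
  obtain ⟨B, rfl⟩ := QuotientGroup.mk_surjective x
  have hdet : B.val.det ≠ 0 := (Matrix.isUnit_iff_isUnit_det _).1 B.isUnit |>.ne_zero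
  obtain ⟨c, hc⟩ := IsAlgClosed.exists_pow_nat_eq (B.val.det)⁻¹ hn
  have hA : (c • B.val).det = 1 := by
    rw [det_smul, Fintype.card_fin, hc, inv_mul_cancel₀ hdet]
  refine ⟨⟨c • B.val, hA⟩, ?_⟩
  rw [eq_comm, QuotientGroup.eq, GeneralLinearGroup.mem_center_iff_val_mem_range_scalar]
  refine ⟨c, ?_⟩
  have : (SpecialLinearGroup.toGL ⟨c • B.val, hA⟩ : GL (Fin n) ℂ).val = c • B.val := rfl
  rw [Units.val_mul, this, mul_smul_comm, Units.inv_mul, scalar_apply, smul_one_eq_diagonal]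

theorem Matrix.SpecialLinearGroup.pow_mul_eq_one_of_toGL_mk_pow_eq_one {n d : ℕ}
    {A : SpecialLinearGroup (Fin n) ℂ}
    (h : (QuotientGroup.mk (SpecialLinearGroup.toGL A) :
      GL (Fin n) ℂ ⧸ Subgroup.center (GL (Fin n) ℂ)) ^ d = 1) : A ^ (n * d) = 1 := by
  rw [← QuotientGroup.mk_pow, QuotientGroup.eq_one_iff, ← map_pow,
    GeneralLinearGroup.mem_center_iff_val_mem_range_scalar] at h
  obtain ⟨c, hc⟩ := h
  have hc : scalar (Fin n) c = (A ^ d).val := hc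
  have hdet : c ^ n = 1 := by
    have := congrArg Matrix.det hc
    simpa using this
  refine Subtype.ext ?_
  rw [mul_comm, pow_mul]
  refine (Matrix.SpecialLinearGroup.coe_pow _ _).trans ?_
  rw [← hc, ← map_pow, hdet, map_one]
  rfl

theorem effective_burnside_pgl (n d : ℕ) (hn : 0 < n) (hd : 0 < d)
    (Γ : Subgroup (GL (Fin n) ℂ ⧸ Subgroup.center (GL (Fin n) ℂ)))
    (h : ∀ g ∈ Γ, g ^ d = 1) :
    Finite Γ ∧ Nat.card Γ ∣ (n * d) ^ n := by
  let π : SpecialLinearGroup (Fin n) ℂ →* GL (Fin n) ℂ ⧸ Subgroup.center (GL (Fin n) ℂ) :=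
    (QuotientGroup.mk' _).comp SpecialLinearGroup.toGL
  let G := Γ.comap π
  have hπ : Function.Surjective (π.subgroupComap Γ) := by
    rintro ⟨x, hx⟩
    obtain ⟨A, rfl⟩ := exists_specialLinearGroup_toGL_mk_eq hn x
    exact ⟨⟨A, hx⟩, rfl⟩
  have hexp : ∀ g : G, g ^ (n * d) = 1 := fun g ↦
    Subtype.ext (Matrix.SpecialLinearGroup.pow_mul_eq_one_of_toGL_mk_pow_eq_one (h _ g.2))
  let ρ : Representation ℂ G (Fin n → ℂ) :=
    (toLinAlgEquiv' : Matrix (Fin n) (Fin n) ℂ ≃ₐ[ℂ] _).toMonoidHom.comp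
      (SpecialLinearGroup.coeMonoidHom.comp G.subtype)
  have hρ : Function.Injective ρ :=
    toLinAlgEquiv'.injective.comp (Subtype.val_injective.comp Subtype.val_injective)
  have hnd := Nat.mul_pos hn hd
  have : Finite G := ρ.finite_of_pow_eq_one hρ hnd hexp
  refine ⟨Finite.of_surjective _ hπ, (Subgroup.card_dvd_of_surjective _ hπ).trans ?_⟩
  simpa only [finrank_fin_fun] using ρ.natCard_dvd_pow_finrank hρ hnd hexp
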